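/- Let m ≥ 3 be an odd integer, n ≥ 6 an even integer, n₁ = n/2 and n₀ = n₁ − 1. Let (a_1,…,a_{n₀}) be one of the following sequences: (1) a_k = mn − n₀ + k for all 1 ≤ k ≤ n₀; (2) a_k = m(n₁ + k) + 1 for all 1 ≤ k ≤ n₀; (3) a_k = 2mk + 1 for all 1 ≤ k ≤ n₀. Then there exist at least 2^m·(m−1)! pairwise Klein bottle nonequivalent C₄-face-magic Klein bottle labelings x on 𝒦_{m,n} satisfying x_{1,k} + x_{1,k+1} = a_k for all 1 ≤ k ≤ n₀. -/

import Mathlib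

/-- Reduction of a (positive) index modulo `n` to a representative in `{1, …, n}`. -/
def wrap (n j : ℕ) : ℕ := if j % n = 0 then n else j % n

/-- `x` is a C₄-face-magic Klein bottle labeling of the `m × n` Klein bottle grid graph
`𝒦_{m,n}` with C₄-face-magic value `S`: `x` is a bijection from `{1,…,m} × {1,…,n}`
onto `{1,…,m*n}` and every C₄-face of the natural embedding of `𝒦_{m,n}` in the Klein
bottle has vertex-label sum `S`. -/
def IsC4FaceMagic (m n : ℕ) (x : ℕ × ℕ → ℕ) (S : ℕ) : Prop :=
  Set.BijOn x (Set.Icc 1 m ×ˢ Set.Icc 1 n) (Set.Icc 1 (m * n)) ∧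
  (∀ i j, 1 ≤ i → i + 1 ≤ m → 1 ≤ j → j ≤ n →
    x (i, j) + x (i + 1, j) + x (i, wrap n (j + 1)) + x (i + 1, wrap n (j + 1)) = S) ∧
  (∀ j, 1 ≤ j → j ≤ n →
    x (m, j) + x (m, wrap n (j + 1)) + x (1, n + 1 - j) + x (1, wrap n (n - j)) = S)

/-- The symmetry `U` of the Klein bottle: `U(i,j) = (i+1,j)` for `1 ≤ i ≤ m-1` and
`U(m,j) = (1, n+1-j)`. -/
def Umap (m n : ℕ) : ℕ × ℕ → ℕ × ℕ := fun p => if p.1 < m then (p.1 + 1, p.2) else (1, n + 1 - p.2)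

/-- The symmetry `H` of the Klein bottle: `H(i,j) = (i, j + n/2)`, second coordinate
taken modulo `n` with representative in `{1,…,n}`. -/
def Hmap (n : ℕ) : ℕ × ℕ → ℕ × ℕ := fun p => (p.1, wrap n (p.2 + n / 2))

/-- The reflection `F` of the Klein bottle: `F(i,j) = (i, n+1-j)`. -/
def Fmap (n : ℕ) : ℕ × ℕ → ℕ × ℕ := fun p => (p.1, n + 1 - p.2)

/-- Membership in the Klein bottle labeling symmetry group `KBLS(m,n)`, the group of
permutations of `{1,…,m} × {1,…,n}` generated by `U`, `H` and `F`. -/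
inductive MemKBLS (m n : ℕ) : (ℕ × ℕ → ℕ × ℕ) → Prop
  | one : MemKBLS m n id
  | genU : MemKBLS m n (Umap m n)
  | genH : MemKBLS m n (Hmap n)
  | genF : MemKBLS m n (Fmap n)
  | comp {f g : ℕ × ℕ → ℕ × ℕ} : MemKBLS m n f → MemKBLS m n g → MemKBLS m n (f ∘ g)

/-- Two labelings of `𝒦_{m,n}` are Klein bottle equivalent if one is obtained from the
other by composing with a member of `KBLS(m,n)`. -/
def KBEquiv (m n : ℕ) (x y : ℕ × ℕ → ℕ) : Prop :=
  ∃ A, MemKBLS m n A ∧ ∀ p ∈ Set.Icc 1 m ×ˢ Set.Icc 1 n, y p = x (A p)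

/-- The sign `1` or `-1` encoded by a Boolean. -/
def boolSign (b : Bool) : ℤ := if b then 1 else -1

lemma boolSign_not (b : Bool) : boolSign (!b) = -boolSign b := by
  cases b <;> simp [boolSign]

/-- The position of the pair of columns containing `j` among the `h` such pairs, counted from the
left in odd rows and from the right in even rows. -/
def pairIndex (h i j : ℕ) : ℕ := if i % 2 = 1 then (j - 1) / 2 else h - 1 - (j - 1) / 2

/-- The centers `±τ i` and the step `2 * g` tile the odd integers between `-2mh` and `2mh` by
progressions of length `h`. -/
structure IsTiling (m h : ℕ) (g : ℤ) (τ : Fin m → ℤ) : Prop where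
  inj : ∀ i i' b b' (l l' : ℕ), l < h → l' < h →
    boolSign b * τ i + g * (2 * l - h + 1) = boolSign b' * τ i' + g * (2 * l' - h + 1) →
    i = i' ∧ b = b' ∧ l = l'
  bound : ∀ i b (l : ℕ), l < h → |boolSign b * τ i + g * (2 * l - h + 1)| < m * (2 * h)
  odd : ∀ i b (l : ℕ), l < h → (boolSign b * τ i + g * (2 * l - h + 1)) % 2 = 1

/-- Twice the deviation of the label at `p` from the average label. -/
def deviation (m h : ℕ) [NeZero m] (g : ℤ) (τ : Fin m → ℤ) (π : Equiv.Perm (Fin m))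
    (s : Fin m → Bool) (p : ℕ × ℕ) : ℤ :=
  boolSign (s (Fin.ofNat m (p.1 - 1)) ^^ decide (p.2 % 2 = 0)) * τ (π (Fin.ofNat m (p.1 - 1))) +
    g * (2 * (pairIndex h p.1 p.2 : ℤ) - h + 1)

open Classical in
/-- The labeling of the `m × 2h` grid whose `i`-th row uses the progressions centered at
`±τ (π i)`, with sign choice `s i`. -/
noncomputable def tilingLabel (m h : ℕ) [NeZero m] (g : ℤ) (τ : Fin m → ℤ)
    (π : Equiv.Perm (Fin m)) (s : Fin m → Bool) (p : ℕ × ℕ) : ℕ :=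
  if p ∈ Set.Icc 1 m ×ˢ Set.Icc 1 (2 * h) then
    ((deviation m h g τ π s p + m * (2 * h) + 1) / 2).toNat else 0

lemma mem_grid {m n i j : ℕ} :
    (i, j) ∈ Set.Icc 1 m ×ˢ Set.Icc 1 n ↔ (1 ≤ i ∧ i ≤ m) ∧ 1 ≤ j ∧ j ≤ n := by
  simp only [Set.mem_prod, Set.mem_Icc]

lemma wrap_of_le {n j : ℕ} (h1 : 1 ≤ j) (h2 : j ≤ n) : wrap n j = j := by
  unfold wrap
  rcases h2.lt_or_eq with h | rfl
  · rw [Nat.mod_eq_of_lt h]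
    split_ifs <;> omega
  · simp

lemma wrap_of_lt_of_le {n j : ℕ} (h1 : n < j) (h2 : j ≤ 2 * n) : wrap n j = j - n := by
  have : wrap n j = wrap n (j - n) := by
    unfold wrap
    rw [Nat.mod_eq_sub_mod h1.le]
  rw [this, wrap_of_le] <;> omega

lemma wrap_zero (n : ℕ) : wrap n 0 = n := by simp [wrap]

lemma pairIndex_lt {h i j : ℕ} (h1 : 1 ≤ j) (h2 : j ≤ 2 * h) : pairIndex h i j < h := by
  unfold pairIndex
  split_ifs <;> omega

lemma ofNat_pred_inj {m i i' : ℕ} [NeZero m] (hi : 1 ≤ i ∧ i ≤ m) (hi' : 1 ≤ i' ∧ i' ≤ m)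
    (h : Fin.ofNat m (i - 1) = Fin.ofNat m (i' - 1)) : i = i' := by
  have := congrArg Fin.val h
  simp only [Fin.ofNat] at this
  rw [Nat.mod_eq_of_lt (by omega), Nat.mod_eq_of_lt (by omega)] at this
  omega

section Label

variable {m h : ℕ} [NeZero m] {g : ℤ} {τ : Fin m → ℤ}

lemma two_mul_tilingLabel (H : IsTiling m h g τ) (π : Equiv.Perm (Fin m)) (s : Fin m → Bool)
    {i j : ℕ} (hi : 1 ≤ i ∧ i ≤ m) (hj : 1 ≤ j ∧ j ≤ 2 * h) :
    2 * (tilingLabel m h g τ π s (i, j) : ℤ) =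
      deviation m h g τ π s (i, j) + m * (2 * h) + 1 := by
  have hl := pairIndex_lt (i := i) hj.1 hj.2
  have hb := abs_lt.1 (H.bound (π (Fin.ofNat m (i - 1)))
    (s (Fin.ofNat m (i - 1)) ^^ decide (j % 2 = 0)) _ hl)
  have ho := H.odd (π (Fin.ofNat m (i - 1)))
    (s (Fin.ofNat m (i - 1)) ^^ decide (j % 2 = 0)) _ hl
  rw [tilingLabel, if_pos (mem_grid.2 ⟨hi, hj⟩)]
  change -_ < deviation m h g τ π s (i, j) ∧ deviation m h g τ π s (i, j) < _ at hb
  change deviation m h g τ π s (i, j) % 2 = 1 at ho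
  have e : (m : ℤ) * (2 * h) = 2 * (m * h) := by ring
  rw [e] at hb ⊢
  generalize (m : ℤ) * h = q at *
  omega

lemma tilingLabel_inj (H : IsTiling m h g τ) {π : Equiv.Perm (Fin m)} {s : Fin m → Bool}
    {i j i' j' : ℕ} (hi : 1 ≤ i ∧ i ≤ m) (hj : 1 ≤ j ∧ j ≤ 2 * h)
    (hi' : 1 ≤ i' ∧ i' ≤ m) (hj' : 1 ≤ j' ∧ j' ≤ 2 * h)
    (e : tilingLabel m h g τ π s (i, j) = tilingLabel m h g τ π s (i', j')) :
    i = i' ∧ j = j' := by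
  have e1 := two_mul_tilingLabel H π s hi hj
  rw [e, two_mul_tilingLabel H π s hi' hj'] at e1
  have e2 : deviation m h g τ π s (i, j) = deviation m h g τ π s (i', j') := by linarith
  obtain ⟨a1, a2, a3⟩ := H.inj _ _ _ _ _ _ (pairIndex_lt hj.1 hj.2) (pairIndex_lt hj'.1 hj'.2) e2
  have a4 := ofNat_pred_inj hi hi' (π.injective a1)
  subst a4
  refine ⟨rfl, ?_⟩
  have a5 := Bool.xor_right_inj.1 a2
  rw [decide_eq_decide] at a5
  simp only [pairIndex] at a3
  split_ifs at a3 <;> omega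

lemma bijOn_tilingLabel (H : IsTiling m h g τ) (π : Equiv.Perm (Fin m)) (s : Fin m → Bool) :
    Set.BijOn (tilingLabel m h g τ π s) (Set.Icc 1 m ×ˢ Set.Icc 1 (2 * h))
      (Set.Icc 1 (m * (2 * h))) := by
  have hmaps : Set.MapsTo (tilingLabel m h g τ π s) (Set.Icc 1 m ×ˢ Set.Icc 1 (2 * h))
      (Set.Icc 1 (m * (2 * h))) := by
    rintro ⟨i, j⟩ hp
    obtain ⟨hi, hj⟩ := mem_grid.1 hp
    have e := two_mul_tilingLabel H π s hi hj
    have hb := abs_lt.1 (H.bound (π (Fin.ofNat m (i - 1)))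
      (s (Fin.ofNat m (i - 1)) ^^ decide (j % 2 = 0)) _ (pairIndex_lt (i := i) hj.1 hj.2))
    change -_ < deviation m h g τ π s (i, j) ∧ deviation m h g τ π s (i, j) < _ at hb
    constructor
    · zify
      linarith
    · zify
      linarith
  have hinj : Set.InjOn (tilingLabel m h g τ π s) (Set.Icc 1 m ×ˢ Set.Icc 1 (2 * h)) := by
    rintro ⟨i, j⟩ hp ⟨i', j'⟩ hp' e
    obtain ⟨hi, hj⟩ := mem_grid.1 hp
    obtain ⟨hi', hj'⟩ := mem_grid.1 hp'
    obtain ⟨rfl, rfl⟩ := tilingLabel_inj H hi hj hi' hj' e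
    rfl
  refine ⟨hmaps, hinj, ?_⟩
  have := Finset.surjOn_of_injOn_of_card_le (s := Finset.Icc 1 m ×ˢ Finset.Icc 1 (2 * h))
    (t := Finset.Icc 1 (m * (2 * h))) (tilingLabel m h g τ π s)
    (by simpa using hmaps) (by simpa using hinj) (by simp)
  simpa using this

/-- Consecutive labels in a row have opposite signs of centers, so their sum depends only on the
row parity and the column. -/
lemma tilingLabel_add_succ (H : IsTiling m h g τ) (π : Equiv.Perm (Fin m)) (s : Fin m → Bool)
    {i j : ℕ} (hi : 1 ≤ i ∧ i ≤ m) (hj : 1 ≤ j ∧ j < 2 * h) :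
    (tilingLabel m h g τ π s (i, j) : ℤ) + tilingLabel m h g τ π s (i, j + 1) =
      m * (2 * h) + 1 + (if i % 2 = 1 then 1 else -1) * (g * (j - h)) := by
  have e1 := two_mul_tilingLabel H π s hi (j := j) (by omega)
  have e2 := two_mul_tilingLabel H π s hi (j := j + 1) (by omega)
  have e3 : (decide ((j + 1) % 2 = 0)) = !decide (j % 2 = 0) := by
    rw [← decide_not, decide_eq_decide]
    omega
  have e4 : (pairIndex h i j : ℤ) + pairIndex h i (j + 1) =
      h - 1 + (if i % 2 = 1 then 1 else -1) * (j - h) := by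
    unfold pairIndex
    split_ifs <;> omega
  simp only [deviation, e3, Bool.xor_not, boolSign_not] at e1 e2
  refine mul_left_cancel₀ (two_ne_zero (α := ℤ)) ?_
  linear_combination e1 + e2 + 2 * g * e4

lemma tilingLabel_add_last (H : IsTiling m h g τ) (π : Equiv.Perm (Fin m)) (s : Fin m → Bool)
    (hh : 1 ≤ h) {i : ℕ} (hi : 1 ≤ i ∧ i ≤ m) :
    (tilingLabel m h g τ π s (i, 2 * h) : ℤ) + tilingLabel m h g τ π s (i, 1) =
      m * (2 * h) + 1 := by
  have e1 := two_mul_tilingLabel H π s hi (j := 2 * h) (by omega)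
  have e2 := two_mul_tilingLabel H π s hi (j := 1) (by omega)
  have e4 : (pairIndex h i (2 * h) : ℤ) + pairIndex h i 1 = h - 1 := by
    unfold pairIndex
    split_ifs <;> omega
  simp [deviation, boolSign_not] at e1 e2
  refine mul_left_cancel₀ (two_ne_zero (α := ℤ)) ?_
  linear_combination e1 + e2 + 2 * g * e4

lemma isC4FaceMagic_tilingLabel (H : IsTiling m h g τ) (π : Equiv.Perm (Fin m))
    (s : Fin m → Bool) (hh : 1 ≤ h) (hm : Odd m) :
    IsC4FaceMagic m (2 * h) (tilingLabel m h g τ π s) (2 * (m * (2 * h) + 1)) := by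
  have hm' := Nat.odd_iff.1 hm
  refine ⟨bijOn_tilingLabel H π s, ?_, ?_⟩
  · intro i j h1 h2 h3 h4
    rcases h4.lt_or_eq with h4 | rfl
    · rw [wrap_of_le (by omega) (by omega)]
      have e1 := tilingLabel_add_succ H π s (i := i) (j := j) (by omega) (by omega)
      have e2 := tilingLabel_add_succ H π s (i := i + 1) (j := j) (by omega) (by omega)
      have e3 : (if (i + 1) % 2 = 1 then (1 : ℤ) else -1) = -(if i % 2 = 1 then 1 else -1) := by
        split_ifs <;> omega
      rw [e3] at e2
      zify
      linear_combination e1 + e2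
    · rw [wrap_of_lt_of_le (by omega) (by omega), Nat.add_sub_cancel_left]
      have e1 := tilingLabel_add_last H π s hh (i := i) (by omega)
      have e2 := tilingLabel_add_last H π s hh (i := i + 1) (by omega)
      zify
      linear_combination e1 + e2
  · intro j h3 h4
    rcases h4.lt_or_eq with h4 | rfl
    · rw [wrap_of_le (by omega) (by omega), wrap_of_le (by omega) (by omega)]
      have e1 := tilingLabel_add_succ H π s (i := m) (j := j) (by omega) (by omega)
      have e2 := tilingLabel_add_succ H π s (i := 1) (j := 2 * h - j) (by omega) (by omega)
      rw [if_pos hm'] at e1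
      rw [if_pos (by norm_num), show 2 * h - j + 1 = 2 * h + 1 - j by omega,
        Nat.cast_sub h4.le] at e2
      push_cast at e2
      zify
      linear_combination e1 + e2
    · rw [wrap_of_lt_of_le (by omega) (by omega), Nat.add_sub_cancel_left, Nat.sub_self, wrap_zero]
      have e1 := tilingLabel_add_last H π s hh (i := m) (by omega)
      have e2 := tilingLabel_add_last H π s hh (i := 1) (by omega)
      zify
      linear_combination e1 + e2

end Label

/-- `κ` agrees on `{1, …, 2h}` with one of the column symmetries generated by the half-turn shift
and the reflection. -/
def IsColumnSymmetry (h : ℕ) (κ : ℕ → ℕ) : Prop :=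
  (∀ j, 1 ≤ j → j ≤ 2 * h → κ j = j) ∨
  (∀ j, 1 ≤ j → j ≤ 2 * h → κ j = 2 * h + 1 - j) ∨
  (∀ j, 1 ≤ j → j ≤ 2 * h → κ j = if j ≤ h then j + h else j - h) ∨
  (∀ j, 1 ≤ j → j ≤ 2 * h → κ j = if j ≤ h then h + 1 - j else 3 * h + 1 - j)

lemma IsColumnSymmetry.mem {h : ℕ} {κ : ℕ → ℕ} (hκ : IsColumnSymmetry h κ) {j : ℕ}
    (h1 : 1 ≤ j) (h2 : j ≤ 2 * h) : 1 ≤ κ j ∧ κ j ≤ 2 * h := by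
  rcases hκ with hκ | hκ | hκ | hκ <;> rw [hκ j h1 h2] <;> (try split_ifs) <;> omega

lemma IsColumnSymmetry.comp {h : ℕ} {κ κ' : ℕ → ℕ} (hκ : IsColumnSymmetry h κ)
    (hκ' : IsColumnSymmetry h κ') : IsColumnSymmetry h (κ ∘ κ') := by
  have key : ∀ j, 1 ≤ j → j ≤ 2 * h → 1 ≤ κ' j ∧ κ' j ≤ 2 * h := fun j => hκ'.mem
  have aux {f : ℕ → ℕ} (hf : ∀ j, 1 ≤ j → j ≤ 2 * h → κ j = f j) (j : ℕ) (h1 : 1 ≤ j)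
      (h2 : j ≤ 2 * h) : (κ ∘ κ') j = f (κ' j) := hf _ (key j h1 h2).1 (key j h1 h2).2
  unfold IsColumnSymmetry
  rcases hκ with hκ | hκ | hκ | hκ <;> rcases hκ' with hκ' | hκ' | hκ' | hκ'
  · left; intro j h1 h2; rw [aux hκ j h1 h2, hκ' j h1 h2]
  · right; left; intro j h1 h2; rw [aux hκ j h1 h2, hκ' j h1 h2]
  · right; right; left; intro j h1 h2; rw [aux hκ j h1 h2, hκ' j h1 h2]
  · right; right; right; intro j h1 h2; rw [aux hκ j h1 h2, hκ' j h1 h2]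
  · right; left; intro j h1 h2; rw [aux hκ j h1 h2, hκ' j h1 h2]
  · left; intro j h1 h2; rw [aux hκ j h1 h2, hκ' j h1 h2]; omega
  · right; right; right; intro j h1 h2; rw [aux hκ j h1 h2, hκ' j h1 h2]; grind
  · right; right; left; intro j h1 h2; rw [aux hκ j h1 h2, hκ' j h1 h2]; grind
  · right; right; left; intro j h1 h2; rw [aux hκ j h1 h2, hκ' j h1 h2]
  · right; right; right; intro j h1 h2; rw [aux hκ j h1 h2, hκ' j h1 h2]; grind
  · left; intro j h1 h2; rw [aux hκ j h1 h2, hκ' j h1 h2]; grind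
  · right; left; intro j h1 h2; rw [aux hκ j h1 h2, hκ' j h1 h2]; grind
  · right; right; right; intro j h1 h2; rw [aux hκ j h1 h2, hκ' j h1 h2]
  · right; right; left; intro j h1 h2; rw [aux hκ j h1 h2, hκ' j h1 h2]; grind
  · right; left; intro j h1 h2; rw [aux hκ j h1 h2, hκ' j h1 h2]; grind
  · left; intro j h1 h2; rw [aux hκ j h1 h2, hκ' j h1 h2]; grind

/-- A Klein bottle symmetry rotates the rows cyclically and acts on each row by a column
symmetry. -/
lemma MemKBLS.exists_rotation {m h : ℕ} (hm : 1 ≤ m) {A : ℕ × ℕ → ℕ × ℕ}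
    (hA : MemKBLS m (2 * h) A) :
    ∃ k, ∀ i, 1 ≤ i → i ≤ m → ∃ κ, IsColumnSymmetry h κ ∧
      ∀ j, 1 ≤ j → j ≤ 2 * h → A (i, j) = ((i - 1 + k) % m + 1, κ j) := by
  induction hA with
  | one =>
    refine ⟨0, fun i h1 h2 => ⟨id, Or.inl fun _ _ _ => rfl, fun j _ _ => ?_⟩⟩
    rw [Nat.mod_eq_of_lt (by omega)]
    simp only [id, Prod.mk.injEq, and_true]
    omega
  | genU =>
    refine ⟨1, fun i h1 h2 => ?_⟩
    rcases h2.lt_or_eq with h2 | rfl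
    · refine ⟨id, Or.inl fun _ _ _ => rfl, fun j _ _ => ?_⟩
      rw [Nat.mod_eq_of_lt (by omega)]
      simp only [Umap, id, if_pos h2, Prod.mk.injEq, and_true]
      omega
    · refine ⟨fun j => 2 * h + 1 - j, Or.inr (Or.inl fun _ _ _ => rfl), fun j _ _ => ?_⟩
      rw [Nat.sub_add_cancel h1, Nat.mod_self]
      simp [Umap]
  | genH =>
    refine ⟨0, fun i h1 h2 => ⟨fun j => if j ≤ h then j + h else j - h,
      Or.inr (Or.inr (Or.inl fun _ _ _ => rfl)), fun j h3 h4 => ?_⟩⟩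
    rw [Nat.mod_eq_of_lt (by omega)]
    simp only [Hmap, Prod.mk.injEq]
    refine ⟨by omega, ?_⟩
    rw [Nat.mul_div_cancel_left _ two_pos]
    split_ifs with hj
    · rw [wrap_of_le (by omega) (by omega)]
    · rw [wrap_of_lt_of_le (by omega) (by omega)]
      omega
  | genF =>
    refine ⟨0, fun i h1 h2 => ⟨fun j => 2 * h + 1 - j, Or.inr (Or.inl fun _ _ _ => rfl),
      fun j _ _ => ?_⟩⟩
    rw [Nat.mod_eq_of_lt (by omega)]
    simp only [Fmap, Prod.mk.injEq, and_true]
    omega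
  | comp hf hg ihf ihg =>
    obtain ⟨k, hk⟩ := ihf
    obtain ⟨k', hk'⟩ := ihg
    refine ⟨k' + k, fun i h1 h2 => ?_⟩
    obtain ⟨κ', c', e'⟩ := hk' i h1 h2
    have := Nat.mod_lt (i - 1 + k') hm
    obtain ⟨κ, c, e⟩ := hk ((i - 1 + k') % m + 1) (by omega) (by omega)
    refine ⟨κ ∘ κ', c.comp c', fun j h3 h4 => ?_⟩
    obtain ⟨h5, h6⟩ := c'.mem h3 h4
    rw [Function.comp_apply, e' j h3 h4, e _ h5 h6]
    simp [← add_assoc]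

section Equivalence

variable {m h : ℕ} [NeZero m] {g : ℤ} {τ : Fin m → ℤ}

lemma eq_of_kbEquiv_tilingLabel (H : IsTiling m h g τ) (hh : 3 ≤ h) (hg : 0 < g)
    {π π' : Equiv.Perm (Fin m)} {s s' : Fin m → Bool} (hπ : π 0 = π' 0)
    (e : KBEquiv m (2 * h) (tilingLabel m h g τ π s) (tilingLabel m h g τ π' s')) :
    tilingLabel m h g τ π s = tilingLabel m h g τ π' s' := by
  have hm : 1 ≤ m := Nat.one_le_iff_ne_zero.2 (NeZero.ne m)
  obtain ⟨A, hA, eA⟩ := e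
  obtain ⟨k, hk⟩ := hA.exists_rotation hm
  have hrow : ∃ j, (1 ≤ j ∧ j ≤ 2 * h) ∧
      tilingLabel m h g τ π' s' (1, 1) = tilingLabel m h g τ π s (1, j) := by
    by_cases hs : s 0 = s' 0
    · refine ⟨1, by omega, ?_⟩
      have e1 := two_mul_tilingLabel H π s (i := 1) (j := 1) (by omega) (by omega)
      have e2 := two_mul_tilingLabel H π' s' (i := 1) (j := 1) (by omega) (by omega)
      simp [deviation, hs, hπ] at e1 e2
      zify
      linarith
    · refine ⟨2, by omega, ?_⟩
      have hs' : s 0 = !s' 0 := by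
        revert hs
        cases s 0 <;> cases s' 0 <;> simp
      have e1 := two_mul_tilingLabel H π s (i := 1) (j := 2) (by omega) (by omega)
      have e2 := two_mul_tilingLabel H π' s' (i := 1) (j := 1) (by omega) (by omega)
      simp [deviation, hs', hπ, pairIndex] at e1 e2
      zify
      linarith
  have hk0 : k % m = 0 := by
    obtain ⟨j, hj, ej⟩ := hrow
    obtain ⟨κ, c, e⟩ := hk 1 le_rfl hm
    have := Nat.mod_lt k hm
    rw [eA (1, 1) (mem_grid.2 (by omega)), e 1 le_rfl (by omega)] at ej
    simp only [Nat.sub_self, zero_add] at ej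
    have := (tilingLabel_inj H (by omega) (c.mem le_rfl (by omega)) (by omega) hj ej).1
    omega
  funext ⟨i, j⟩
  by_cases hp : (i, j) ∈ Set.Icc 1 m ×ˢ Set.Icc 1 (2 * h)
  swap
  · rw [tilingLabel, tilingLabel, if_neg hp, if_neg hp]
  obtain ⟨hi, hj⟩ := mem_grid.1 hp
  obtain ⟨κ, c, e⟩ := hk i hi.1 hi.2
  have hi' : (i - 1 + k) % m + 1 = i := by
    rw [Nat.add_mod, hk0, add_zero, Nat.mod_mod, Nat.mod_eq_of_lt (by omega)]
    omega
  rw [hi'] at e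
  have ey : ∀ j, 1 ≤ j → j ≤ 2 * h →
      tilingLabel m h g τ π' s' (i, j) = tilingLabel m h g τ π s (i, κ j) := by
    intro j h1 h2
    rw [eA (i, j) (mem_grid.2 (by omega)), e j h1 h2]
  have d := tilingLabel_add_succ H π' s' hi (j := 1) (by omega)
  rw [ey 1 (by omega) (by omega), ey 2 (by omega) (by omega)] at d
  have hh' : (3 : ℤ) ≤ h := by exact_mod_cast hh
  rcases c with c | c | c | c
  · rw [ey j hj.1 hj.2, c j hj.1 hj.2]
  · exfalso
    rw [c 1 (by omega) (by omega), c 2 (by omega) (by omega)] at d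
    have d' := tilingLabel_add_succ H π s hi (j := 2 * h - 1) (by omega)
    rw [show 2 * h - 1 + 1 = 2 * h by omega] at d'
    rw [show 2 * h + 1 - 1 = 2 * h by omega, show 2 * h + 1 - 2 = 2 * h - 1 by omega] at d
    rw [Nat.cast_sub (by omega)] at d'
    push_cast at d d'
    split_ifs at d d' <;> nlinarith
  · exfalso
    rw [c 1 (by omega) (by omega), c 2 (by omega) (by omega), if_pos (by omega),
      if_pos (by omega)] at d
    have d' := tilingLabel_add_succ H π s hi (j := 1 + h) (by omega)
    rw [show 1 + h + 1 = 2 + h by omega] at d'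
    push_cast at d d'
    split_ifs at d d' <;> nlinarith
  · exfalso
    rw [c 1 (by omega) (by omega), c 2 (by omega) (by omega), if_pos (by omega),
      if_pos (by omega)] at d
    have d' := tilingLabel_add_succ H π s hi (j := h - 1) (by omega)
    rw [show h - 1 + 1 = h by omega] at d'
    rw [show h + 1 - 1 = h by omega, show h + 1 - 2 = h - 1 by omega] at d
    rw [Nat.cast_sub (by omega)] at d'
    push_cast at d d'
    split_ifs at d d' <;> nlinarith

lemma tilingLabel_params_inj (H : IsTiling m h g τ) (hh : 1 ≤ h) {π π' : Equiv.Perm (Fin m)}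
    {s s' : Fin m → Bool} (e : tilingLabel m h g τ π s = tilingLabel m h g τ π' s') :
    π = π' ∧ s = s' := by
  have key : ∀ i : Fin m, π i = π' i ∧ s i = s' i := by
    intro i
    have hi : 1 ≤ i.val + 1 ∧ i.val + 1 ≤ m := by omega
    have e1 := two_mul_tilingLabel H π s hi (j := 1) (by omega)
    have e2 := two_mul_tilingLabel H π' s' hi (j := 1) (by omega)
    rw [e] at e1
    have e3 : deviation m h g τ π s (i.val + 1, 1) = deviation m h g τ π' s' (i.val + 1, 1) := by
      linarith
    have h0 : Fin.ofNat m (i.val + 1 - 1) = i := by ext; simp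
    have hl := pairIndex_lt (i := i.val + 1) (j := 1) le_rfl (show 1 ≤ 2 * h by omega)
    simp only [deviation, h0] at e3
    obtain ⟨a1, a2, -⟩ := H.inj _ _ _ _ _ _ hl hl e3
    exact ⟨a1, Bool.xor_left_inj.1 a2⟩
  exact ⟨Equiv.ext fun i => (key i).1, funext fun i => (key i).2⟩

end Equivalence

/-- A tiling gives `2 ^ m * (m - 1)!` pairwise nonequivalent labelings whose first-row adjacent sums
form an arithmetic progression. -/
lemma IsTiling.exists_labelings {m h : ℕ} {g : ℤ} {τ : Fin m → ℤ} (H : IsTiling m h g τ)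
    (hm : Odd m) (hh : 3 ≤ h) (hg : 0 < g) :
    ∃ T : Finset (ℕ × ℕ → ℕ),
      2 ^ m * Nat.factorial (m - 1) ≤ T.card ∧
      (∀ x ∈ T, (∃ S, IsC4FaceMagic m (2 * h) x S) ∧
        ∀ k, 1 ≤ k → k ≤ h - 1 →
          (x (1, k) : ℤ) + x (1, k + 1) = m * (2 * h) + 1 + g * (k - h)) ∧
      (∀ x ∈ T, ∀ y ∈ T, x ≠ y → ¬ KBEquiv m (2 * h) x y) := by
  classical
  obtain ⟨M, rfl⟩ : ∃ M, m = M + 1 := ⟨m - 1, by have := hm.pos; omega⟩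
  let P (q : Equiv.Perm (Fin M)) : Equiv.Perm (Fin (M + 1)) :=
    Equiv.Perm.decomposeFin.symm (0, q)
  let f (q : Equiv.Perm (Fin M) × (Fin (M + 1) → Bool)) : ℕ × ℕ → ℕ :=
    tilingLabel (M + 1) h g τ (P q.1) q.2
  have hf : Function.Injective f := by
    rintro ⟨q, s⟩ ⟨q', s'⟩ e
    obtain ⟨e1, rfl⟩ := tilingLabel_params_inj H (by omega) e
    have e2 := Equiv.Perm.decomposeFin.symm.injective e1
    rw [Prod.mk.injEq] at e2
    exact Prod.ext e2.2 rfl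
  refine ⟨Finset.univ.image f, ?_, ?_, ?_⟩
  · rw [Finset.card_image_of_injective _ hf]
    simp [Fintype.card_perm, mul_comm]
  · intro x hx
    obtain ⟨q, -, rfl⟩ := Finset.mem_image.1 hx
    refine ⟨⟨_, isC4FaceMagic_tilingLabel H _ _ (by omega) hm⟩, fun k h1 h2 => ?_⟩
    have := tilingLabel_add_succ H (P q.1) q.2 (i := 1) (j := k) (by omega) (by omega)
    simpa using this
  · intro x hx y hy hne e
    obtain ⟨q, -, rfl⟩ := Finset.mem_image.1 hx
    obtain ⟨q', -, rfl⟩ := Finset.mem_image.1 hy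
    exact hne (eq_of_kbEquiv_tilingLabel H hh hg (by simp [P]) e)

lemma eq_zero_of_mul_eq_of_abs_lt {q d e : ℤ} (h : d = q * e) (hd : |d| < q) : e = 0 := by
  have hq : 0 < q := (abs_nonneg d).trans_lt hd
  rw [h, abs_mul, abs_of_pos hq] at hd
  have : |e| < 1 := by nlinarith
  exact Int.abs_lt_one_iff.1 this

lemma isTiling_consecutive {m h : ℕ} :
    IsTiling m h 1 (fun i => h * (2 * (i : ℤ) + 1)) where
  inj := by
    rintro i i' b b' l l' hl hl' e
    have key : ∃ v : ℤ, boolSign b' * (2 * (i' : ℤ) + 1) - boolSign b * (2 * (i : ℤ) + 1) =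
        2 * v := by
      cases b <;> cases b' <;> simp only [boolSign, if_true, Bool.false_eq_true, if_false]
      · exact ⟨i - i', by ring⟩
      · exact ⟨i + i' + 1, by ring⟩
      · exact ⟨-(i + i' + 1), by ring⟩
      · exact ⟨i' - i, by ring⟩
    obtain ⟨v, hv⟩ := key
    have h1 : (l : ℤ) - l' = h * v := by
      refine mul_left_cancel₀ (two_ne_zero (α := ℤ)) ?_
      linear_combination e + h * hv
    have h2 := eq_zero_of_mul_eq_of_abs_lt h1 (by rw [abs_lt]; omega)
    subst h2
    have hl : l = l' := by
      have : (l : ℤ) - l' = 0 := by simpa using h1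
      omega
    refine ⟨?_, ?_, hl⟩ <;> cases b <;> cases b' <;> simp [boolSign] at hv ⊢ <;> omega
  bound := by
    rintro i b l hl
    have h1 : (i : ℤ) + 1 ≤ m := by exact_mod_cast i.isLt
    have h2 : (l : ℤ) + 1 ≤ h := by exact_mod_cast hl
    have h3 : (0 : ℤ) ≤ (i : ℤ) := by positivity
    have h4 : (0 : ℤ) ≤ (l : ℤ) := by positivity
    rw [abs_lt]
    cases b <;> simp only [boolSign, if_true, Bool.false_eq_true, if_false] <;>
      constructor <;> nlinarith
  odd := by
    rintro i b l hl
    rw [← Int.odd_iff]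
    cases b <;> simp only [boolSign, if_true, Bool.false_eq_true, if_false]
    · exact ⟨-h * (i + 1) + l, by ring⟩
    · exact ⟨h * i + l, by ring⟩

lemma isTiling_residues {m h : ℕ} :
    IsTiling m h m (fun i => 2 * (i : ℤ) + 1 + m * (h - 1)) where
  inj := by
    rintro i i' b b' l l' hl hl' e
    have h1 : (i : ℤ) + 1 ≤ m := by exact_mod_cast i.isLt
    have h1' : (i' : ℤ) + 1 ≤ m := by exact_mod_cast i'.isLt
    have h2 : (l : ℤ) + 1 ≤ h := by exact_mod_cast hl
    have h2' : (l' : ℤ) + 1 ≤ h := by exact_mod_cast hl'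
    have h3 : (0 : ℤ) ≤ (i : ℤ) := by positivity
    have h3' : (0 : ℤ) ≤ (i' : ℤ) := by positivity
    have h4 : (0 : ℤ) ≤ (l : ℤ) := by positivity
    have h4' : (0 : ℤ) ≤ (l' : ℤ) := by positivity
    have same (e : (i : ℤ) - i' = m * (l' - l) ∨ (i' : ℤ) - i = m * (l' - l)) :
        i = i' ∧ l = l' := by
      have h5 : (l' : ℤ) - l = 0 := by
        rcases e with e | e <;> exact eq_zero_of_mul_eq_of_abs_lt e (by rw [abs_lt]; omega)
      rw [h5, mul_zero] at e
      constructor <;> omega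
    cases b <;> cases b' <;>
      simp only [boolSign, if_true, Bool.false_eq_true, if_false] at e ⊢
    · simpa using same (Or.inr (by linarith))
    · exfalso
      nlinarith
    · exfalso
      nlinarith
    · simpa using same (Or.inl (by linarith))
  bound := by
    rintro i b l hl
    have h1 : (i : ℤ) + 1 ≤ m := by exact_mod_cast i.isLt
    have h2 : (l : ℤ) + 1 ≤ h := by exact_mod_cast hl
    have h3 : (0 : ℤ) ≤ (i : ℤ) := by positivity
    have h4 : (0 : ℤ) ≤ (l : ℤ) := by positivity
    rw [abs_lt]
    cases b <;> simp only [boolSign, if_true, Bool.false_eq_true, if_false] <;>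
      constructor <;> nlinarith
  odd := by
    rintro i b l hl
    rw [← Int.odd_iff]
    cases b <;> simp only [boolSign, if_true, Bool.false_eq_true, if_false]
    · exact ⟨-i - 1 + m * (l - h + 1), by ring⟩
    · exact ⟨i + m * l, by ring⟩

lemma isTiling_doubledResidues {m h : ℕ} :
    IsTiling m h (2 * m) (fun i => 2 * (i : ℤ) + 1) where
  inj := by
    rintro i i' b b' l l' hl hl' e
    have h1 : (i : ℤ) + 1 ≤ m := by exact_mod_cast i.isLt
    have h1' : (i' : ℤ) + 1 ≤ m := by exact_mod_cast i'.isLt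
    have e' : boolSign b * (2 * (i : ℤ) + 1) - boolSign b' * (2 * (i' : ℤ) + 1) =
        4 * m * (l' - l) := by linear_combination e
    have h5 := eq_zero_of_mul_eq_of_abs_lt e' (by
      rw [abs_lt]
      cases b <;> cases b' <;> simp only [boolSign, if_true, Bool.false_eq_true, if_false] <;>
        omega)
    rw [h5, mul_zero] at e'
    refine ⟨?_, ?_, by omega⟩ <;> cases b <;> cases b' <;> simp [boolSign] at e' ⊢ <;> omega
  bound := by
    rintro i b l hl
    have h1 : (i : ℤ) + 1 ≤ m := by exact_mod_cast i.isLt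
    have h2 : (l : ℤ) + 1 ≤ h := by exact_mod_cast hl
    have h3 : (0 : ℤ) ≤ (i : ℤ) := by positivity
    have h4 : (0 : ℤ) ≤ (l : ℤ) := by positivity
    rw [abs_lt]
    cases b <;> simp only [boolSign, if_true, Bool.false_eq_true, if_false] <;>
      constructor <;> nlinarith
  odd := by
    rintro i b l hl
    rw [← Int.odd_iff]
    cases b <;> simp only [boolSign, if_true, Bool.false_eq_true, if_false]
    · exact ⟨-i - 1 + m * (2 * l - h + 1), by ring⟩
    · exact ⟨i + m * (2 * l - h + 1), by ring⟩

/-- Let `m ≥ 3` be odd, `n ≥ 6` even, `n₁ = n/2`, `n₀ = n₁ - 1`, and let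
`(a_1, …, a_{n₀})` be one of the sequences `a_k = mn - n₀ + k`, `a_k = m(n₁+k) + 1`, or
`a_k = 2mk + 1`. Then there are at least `2^m * (m-1)!` pairwise Klein bottle nonequivalent
C₄-face-magic Klein bottle labelings `x` on `𝒦_{m,n}` with `x_{1,k} + x_{1,k+1} = a_k` for
all `1 ≤ k ≤ n₀`. -/
theorem kleinBottle_lower_sequences (m n : ℕ) (a : ℕ → ℕ) (hm : 3 ≤ m) (hmo : Odd m)
    (hn : 6 ≤ n) (hne : Even n)
    (ha : (∀ k, 1 ≤ k → k ≤ n / 2 - 1 → a k = m * n - (n / 2 - 1) + k) ∨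
          (∀ k, 1 ≤ k → k ≤ n / 2 - 1 → a k = m * (n / 2 + k) + 1) ∨
          (∀ k, 1 ≤ k → k ≤ n / 2 - 1 → a k = 2 * m * k + 1)) :
    ∃ T : Finset (ℕ × ℕ → ℕ),
      2 ^ m * Nat.factorial (m - 1) ≤ T.card ∧
      (∀ x ∈ T, (∃ S, IsC4FaceMagic m n x S) ∧
        ∀ k, 1 ≤ k → k ≤ n / 2 - 1 → x (1, k) + x (1, k + 1) = a k) ∧
      (∀ x ∈ T, ∀ y ∈ T, x ≠ y → ¬ KBEquiv m n x y) := by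
  obtain ⟨h, rfl⟩ := hne.two_dvd
  have hh : 3 ≤ h := by omega
  rw [Nat.mul_div_cancel_left _ two_pos] at *
  have hm0 : (0 : ℤ) < m := by exact_mod_cast (by omega : 0 < m)
  have transfer (g : ℤ) (τ : Fin m → ℤ) (H : IsTiling m h g τ) (hg : 0 < g)
      (hs : ∀ k, 1 ≤ k → k ≤ h - 1 → (a k : ℤ) = m * (2 * h) + 1 + g * (k - h)) :
      ∃ T : Finset (ℕ × ℕ → ℕ),
        2 ^ m * Nat.factorial (m - 1) ≤ T.card ∧
        (∀ x ∈ T, (∃ S, IsC4FaceMagic m (2 * h) x S) ∧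
          ∀ k, 1 ≤ k → k ≤ h - 1 → x (1, k) + x (1, k + 1) = a k) ∧
        (∀ x ∈ T, ∀ y ∈ T, x ≠ y → ¬ KBEquiv m (2 * h) x y) := by
    obtain ⟨T, h1, h2, h3⟩ := H.exists_labelings hmo hh hg
    refine ⟨T, h1, fun x hx => ⟨(h2 x hx).1, fun k hk hk' => ?_⟩, h3⟩
    have := (h2 x hx).2 k hk hk'
    rw [← hs k hk hk'] at this
    exact_mod_cast this
  rcases ha with ha | ha | ha
  · refine transfer _ _ isTiling_consecutive one_pos fun k h1 h2 => ?_
    have : h - 1 ≤ m * (2 * h) := (Nat.sub_le _ _).trans (by nlinarith)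
    rw [ha k h1 h2]
    push_cast [Nat.cast_sub this, Nat.cast_sub (show 1 ≤ h by omega)]
    ring
  · refine transfer _ _ isTiling_residues hm0 fun k h1 h2 => ?_
    rw [ha k h1 h2]
    push_cast
    ring
  · refine transfer _ _ isTiling_doubledResidues (by positivity) fun k h1 h2 => ?_
    rw [ha k h1 h2]
    push_cast
    ring
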